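/- Low demand uncertainty case, optimal order quantity: Let h ∈ H₂ and suppose r ≤ Δ_{s*,1}/(h'(1) − (1−β)). Then for any value h^τ(s*) in the interval [h'(s*), h'(s*+)] (between the left and right derivatives of h at s*), the order quantity x* = μ − σ·(h^τ(s*) − 2(1−β))/(2Δ_{s*,1}) attains the infimum in the worst-case problem, i.e., sup_{F ∈ S(μ,σ)} ρ_h^F(ψ(x*,p,c)) = ρ_h^wc(μ,σ). -/

import Mathlib

open MeasureTheory Set

namespace NV

noncomputable section

/-- `hD h u`: the left derivative of `h` at `u` for `u ≠ 0`, and the right derivative at `0`. -/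
def hD (h : ℝ → ℝ) (u : ℝ) : ℝ :=
  if u = 0 then derivWithin h (Set.Ioi (0 : ℝ)) 0 else derivWithin h (Set.Iio u) u

/-- A distortion function: nondecreasing on `[0,1]` with `h 0 = 0`, `h 1 = 1`. -/
def IsDistortion (h : ℝ → ℝ) : Prop :=
  MonotoneOn h (Set.Icc (0 : ℝ) 1) ∧ h 0 = 0 ∧ h 1 = 1

/-- Membership in `H₂`: a convex distortion function with square-integrable derivative. -/
def MemH2 (h : ℝ → ℝ) : Prop :=
  IsDistortion h ∧ ConvexOn ℝ (Set.Icc (0 : ℝ) 1) h ∧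
    IntegrableOn (fun u => (hD h u) ^ 2) (Set.Ioo (0 : ℝ) 1)

/-- Value-at-risk of `X` at level `α` under `P`. -/
def VaR {Ω : Type*} [MeasurableSpace Ω] (P : Measure Ω) (X : Ω → ℝ) (α : ℝ) : ℝ :=
  sInf {t : ℝ | α ≤ (P {ω | X ω ≤ t}).toReal}

/-- Distortion functional `ρ_h(X) = ∫₀¹ VaR_u(X) h'(u) du`. -/
def rho {Ω : Type*} [MeasurableSpace Ω] (h : ℝ → ℝ) (P : Measure Ω) (X : Ω → ℝ) : ℝ :=
  ∫ u in Set.Ioo (0 : ℝ) 1, VaR P X u * hD h u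

/-- Loss of ordering `x`: `ψ(x,p,c) = p·max{−S,−x} + c·x`, as a function of demand `s`. -/
def loss (p c x s : ℝ) : ℝ := p * max (-s) (-x) + c * x

/-- Distributions on `[0,∞)` with mean `μ` and second moment `μ² + σ²`. -/
def momentSet (μ σ : ℝ) : Set (Measure ℝ) :=
  {P | IsProbabilityMeasure P ∧ P (Set.Iio (0 : ℝ)) = 0 ∧
      (∫ s, s ∂P) = μ ∧ (∫ s, s ^ 2 ∂P) = μ ^ 2 + σ ^ 2}

/-- Inner worst-case risk `sup_{F ∈ S(μ,σ)} ρ_h^F(ψ(x,p,c))` at order quantity `x`. -/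
def wcInner (h : ℝ → ℝ) (p c μ σ x : ℝ) : ℝ :=
  sSup ((fun P => rho h P (loss p c x)) '' momentSet μ σ)

/-- Worst-case risk `ρ_h^wc(μ,σ) = inf_{x ≥ 0} sup_{F ∈ S(μ,σ)} ρ_h^F(ψ(x,p,c))`. -/
def wcRisk (h : ℝ → ℝ) (p c μ σ : ℝ) : ℝ :=
  sInf ((fun x => wcInner h p c μ σ x) '' Set.Ici (0 : ℝ))

/-- Generalized inverse `s* = h⁻¹(β)`. -/
def sstar (h : ℝ → ℝ) (β : ℝ) : ℝ := sInf {u ∈ Set.Icc (0 : ℝ) 1 | β ≤ h u}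

/-- `Δ_{s,t} = sqrt(t ∫_s^t h'(u)² du − (h(t) − β)²)`. -/
def Del (h : ℝ → ℝ) (β s t : ℝ) : ℝ :=
  Real.sqrt (t * (∫ u in Set.Ioc s t, (hD h u) ^ 2) - (h t - β) ^ 2)

/-- `σ_t = sqrt(t (μ² + σ²) − μ²)`. -/
def sigt (μ σ t : ℝ) : ℝ := Real.sqrt (t * (μ ^ 2 + σ ^ 2) - μ ^ 2)

/-- `h_s(u) = (h(u) − h(s))/(1 − h(s))` for `s < u ≤ 1`, and `0` otherwise. -/
def hsub (h : ℝ → ℝ) (s u : ℝ) : ℝ :=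
  if s < u ∧ u ≤ 1 then (h u - h s) / (1 - h s) else 0

/-- `k_{s,t}`. -/
def kst (h : ℝ → ℝ) (μ σ s t : ℝ) : ℝ :=
  sigt μ σ t /
    Real.sqrt (t * (∫ u in Set.Ioc (0 : ℝ) t, (hD (hsub h s) u) ^ 2) - (hsub h s t) ^ 2)

/-- `ℓ_{s,t}`. -/
def lst (h : ℝ → ℝ) (μ σ s t : ℝ) : ℝ :=
  -(μ / t) - kst h μ σ s t * hsub h s t / t

/-- The feasible region `D`. -/
def Dset (h : ℝ → ℝ) (μ σ : ℝ) : Set (ℝ × ℝ) :=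
  {q | 0 ≤ q.1 ∧ q.1 ≤ q.2 ∧ q.2 ≤ 1 ∧ μ ^ 2 / (μ ^ 2 + σ ^ 2) ≤ q.2 ∧
      kst h μ σ q.1 q.2 * hD (hsub h q.1) q.2 + lst h μ σ q.1 q.2 ≤ 0}

/-- `g_x(s,t)`. -/
def gfun (h : ℝ → ℝ) (μ σ x : ℝ) (q : ℝ × ℝ) : ℝ :=
  -(h q.1) * x - (μ / q.2) * (h q.2 - h q.1) +
    (sigt μ σ q.2 / q.2) *
      Real.sqrt (q.2 * (∫ u in Set.Ioc q.1 q.2, (hD h u) ^ 2) - (h q.2 - h q.1) ^ 2)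

/-- `t*`: the largest `t ∈ [1/(1+r²),1]` satisfying the defining inequality. -/
def tstar (h : ℝ → ℝ) (β r : ℝ) : ℝ :=
  sSup {t ∈ Set.Icc (1 / (1 + r ^ 2)) (1 : ℝ) |
    (1 + r ^ 2) * (t * hD h t - h t + β) ^ 2 -
      (∫ u in Set.Ioo (0 : ℝ) 1, (hD h u - h t + β) ^ 2) ≤ 0}

end

end NV

open NV MeasureTheory

namespace NV

section Quantile

variable {Ω : Type*} [MeasurableSpace Ω] {P : Measure Ω} [IsProbabilityMeasure P] {X : Ω → ℝ}
  {u : ℝ}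

instance : IsProbabilityMeasure (volume.restrict (Ioo (0 : ℝ) 1)) :=
  ⟨by simp⟩

/-- The Galois connection between quantile function and distribution function. -/
lemma VaR_le_iff (hX : Measurable X) (hu : u ∈ Ioo (0 : ℝ) 1) (t : ℝ) :
    VaR P X u ≤ t ↔ u ≤ (P {ω | X ω ≤ t}).toReal := by
  have : IsProbabilityMeasure (P.map X) := Measure.isProbabilityMeasure_map hX.aemeasurable
  have hcdf (t : ℝ) : (P {ω | X ω ≤ t}).toReal = ProbabilityTheory.cdf (P.map X) t := by
    rw [ProbabilityTheory.cdf_eq_real, measureReal_def, Measure.map_apply hX measurableSet_Iic]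
    rfl
  simp only [VaR, hcdf]
  set F := ProbabilityTheory.cdf (P.map X)
  have hmono : Monotone F := ProbabilityTheory.monotone_cdf _
  obtain ⟨a, ha⟩ := ((ProbabilityTheory.tendsto_cdf_atBot (P.map X)).eventually_lt_const hu.1).exists
  obtain ⟨b, hb⟩ := ((ProbabilityTheory.tendsto_cdf_atTop (P.map X)).eventually_const_lt hu.2).exists
  have hbdd : BddBelow {t | u ≤ F t} :=
    ⟨a, fun t ht => le_of_not_gt fun hlt => (ha.trans_le ht).not_ge (hmono hlt.le)⟩
  have hne : {t | u ≤ F t}.Nonempty := ⟨b, hb.le⟩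
  refine ⟨fun h => le_trans ?_ (hmono h), fun h => csInf_le hbdd h⟩
  have hcont : Filter.Tendsto F (nhdsWithin (sInf {t | u ≤ F t}) (Ioi _)) (nhds (F _)) :=
    ((F.right_continuous _).mono Ioi_subset_Ici_self).tendsto
  refine ge_of_tendsto hcont (eventually_nhdsWithin_of_forall fun t ht => ?_)
  obtain ⟨d, hd, hdt⟩ := exists_lt_of_csInf_lt hne ht
  exact le_trans hd (hmono hdt.le)

lemma monotoneOn_VaR (hX : Measurable X) : MonotoneOn (VaR P X) (Ioo 0 1) :=
  fun _ hu _ hv huv => (VaR_le_iff hX hu _).2 (huv.trans ((VaR_le_iff hX hv _).1 le_rfl))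

lemma aemeasurable_VaR (hX : Measurable X) :
    AEMeasurable (VaR P X) (volume.restrict (Ioo 0 1)) :=
  aemeasurable_restrict_of_monotoneOn measurableSet_Ioo (monotoneOn_VaR hX)

/-- The quantile function of `X` under the uniform law has the law of `X`. -/
lemma map_VaR (hX : Measurable X) :
    (volume.restrict (Ioo (0 : ℝ) 1)).map (VaR P X) = P.map X := by
  have : IsProbabilityMeasure (P.map X) := Measure.isProbabilityMeasure_map hX.aemeasurable
  have : IsProbabilityMeasure ((volume.restrict (Ioo (0 : ℝ) 1)).map (VaR P X)) :=
    Measure.isProbabilityMeasure_map (aemeasurable_VaR hX)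
  refine Measure.ext_of_Iic _ _ fun t => ?_
  rw [Measure.map_apply_of_aemeasurable (aemeasurable_VaR hX) measurableSet_Iic,
    Measure.restrict_apply' measurableSet_Ioo, Measure.map_apply hX measurableSet_Iic]
  have hset : VaR P X ⁻¹' Iic t ∩ Ioo 0 1 = Iic (P {ω | X ω ≤ t}).toReal ∩ Ioo 0 1 := by
    ext u
    simp only [mem_inter_iff, mem_preimage, mem_Iic, and_congr_left_iff]
    exact fun hu => VaR_le_iff hX hu t
  rw [hset]
  have h1 : (P {ω | X ω ≤ t}).toReal ≤ 1 := measureReal_le_one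
  have hF : P (X ⁻¹' Iic t) = ENNReal.ofReal (P {ω | X ω ≤ t}).toReal := by
    rw [ENNReal.ofReal_toReal (measure_ne_top _ _)]
    rfl
  rw [hF]
  set F := (P {ω | X ω ≤ t}).toReal
  apply le_antisymm
  · have hsub : Iic F ∩ Ioo 0 1 ⊆ Ioc 0 F := fun u hu => ⟨hu.2.1, hu.1⟩
    calc _ ≤ volume (Ioc 0 F) := measure_mono hsub
      _ = ENNReal.ofReal F := by simp
  · have hsub : Ioo 0 F ⊆ Iic F ∩ Ioo 0 1 := fun u hu => ⟨hu.2.le, hu.1, hu.2.trans_le h1⟩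
    calc ENNReal.ofReal F = volume (Ioo 0 F) := by simp
      _ ≤ _ := measure_mono hsub

lemma VaR_loss {P : Measure ℝ} [IsProbabilityMeasure P] {p c x : ℝ} (hp : 0 < p)
    (hu : u ∈ Ioo (0 : ℝ) 1) :
    VaR P (loss p c x) u = p * max (VaR P (fun s => -s) u) (-x) + c * x := by
  have hm : Measurable (loss p c x) := by unfold loss; fun_prop
  refine eq_of_forall_ge_iff fun t => ?_
  have aux (a : ℝ) : p * max a (-x) + c * x ≤ t ↔ a ≤ (t - c * x) / p ∧ -x ≤ (t - c * x) / p := by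
    rw [← max_le_iff, le_div_iff₀ hp, le_sub_iff_add_le, mul_comm]
  rw [VaR_le_iff hm hu, aux, VaR_le_iff measurable_neg hu]
  simp only [loss, aux]
  by_cases hx : -x ≤ (t - c * x) / p
  · simp [hx]
  · simp [hx, hu.1]

end Quantile

section Distortion

variable {h : ℝ → ℝ}

lemma hD_of_ne_zero {u : ℝ} (hu : u ≠ 0) : hD h u = derivWithin h (Iio u) u := if_neg hu

lemma monotoneOn_hD (hc : ConvexOn ℝ (Icc 0 1) h) : MonotoneOn (hD h) (Ioo 0 1) := by
  have := hc.monotoneOn_leftDeriv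
  rw [interior_Icc] at this
  exact this.congr fun u hu => (hD_of_ne_zero hu.1.ne').symm

lemma hD_nonneg (hh : MonotoneOn h (Icc 0 1)) {u : ℝ} (hu : u ∈ Ioo (0 : ℝ) 1) : 0 ≤ hD h u := by
  rw [hD_of_ne_zero hu.1.ne', ← derivWithin_inter (Ioi_mem_nhds hu.1), inter_comm, Ioi_inter_Iio]
  refine MonotoneOn.derivWithin_nonneg fun a ha b hb hab => hh ?_ ?_ hab
  · exact ⟨ha.1.le, (ha.2.trans hu.2).le⟩
  · exact ⟨hb.1.le, (hb.2.trans hu.2).le⟩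

lemma hasDerivWithinAt_hD (hc : ConvexOn ℝ (Icc 0 1) h) {u : ℝ} (hu : u ∈ Ioo (0 : ℝ) 1) :
    HasDerivWithinAt h (hD h u) (Iio u) u := by
  rw [hD_of_ne_zero hu.1.ne']
  exact hc.hasDerivWithinAt_leftDeriv_of_mem_interior (by rwa [interior_Icc])

lemma hasDerivWithinAt_hD_one (h1 : hD h 1 ≠ 0) : HasDerivWithinAt h (hD h 1) (Iio 1) 1 := by
  rw [hD_of_ne_zero one_ne_zero] at h1 ⊢
  exact (differentiableWithinAt_of_derivWithin_ne_zero h1).hasDerivWithinAt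

lemma rightDeriv_le_hD (hc : ConvexOn ℝ (Icc 0 1) h) {s u : ℝ} (hs : 0 < s) (hsu : s < u)
    (hu : u < 1) : derivWithin h (Ioi s) s ≤ hD h u := by
  have hs' : s ∈ interior (Icc (0 : ℝ) 1) := by
    rw [interior_Icc]; exact ⟨hs, hsu.trans hu⟩
  have hu' : u ∈ interior (Icc (0 : ℝ) 1) := by
    rw [interior_Icc]; exact ⟨hs.trans hsu, hu⟩
  rw [hD_of_ne_zero (hs.trans hsu).ne']
  exact (hc.rightDeriv_le_slope_of_mem_interior hs' (interior_subset hu') hsu).trans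
    (hc.slope_le_leftDeriv_of_mem_interior (interior_subset hs') hu' hsu)

lemma rightDeriv_le_hD_one (hc : ConvexOn ℝ (Icc 0 1) h) (h1 : hD h 1 ≠ 0) {u : ℝ}
    (hu : u ∈ Ioo (0 : ℝ) 1) : derivWithin h (Ioi u) u ≤ hD h 1 := by
  have hu' : u ∈ interior (Icc (0 : ℝ) 1) := by rwa [interior_Icc]
  have h1m : (1 : ℝ) ∈ Icc (0 : ℝ) 1 := ⟨zero_le_one, le_rfl⟩
  exact (hc.rightDeriv_le_slope_of_mem_interior hu' h1m hu.2).trans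
    (hc.slope_le_of_hasDerivWithinAt_Iio (interior_subset hu') h1m hu.2
      (hasDerivWithinAt_hD_one h1))

lemma hD_le_hD_one (hc : ConvexOn ℝ (Icc 0 1) h) (h1 : hD h 1 ≠ 0) {u : ℝ}
    (hu : u ∈ Ioo (0 : ℝ) 1) : hD h u ≤ hD h 1 := by
  refine le_trans ?_ (rightDeriv_le_hD_one hc h1 hu)
  rw [hD_of_ne_zero hu.1.ne']
  exact hc.leftDeriv_le_rightDeriv_of_mem_interior (by rwa [interior_Icc])

lemma continuousOn_distortion (hd : IsDistortion h) (hc : ConvexOn ℝ (Icc 0 1) h)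
    (h1 : hD h 1 ≠ 0) : ContinuousOn h (Icc 0 1) := by
  obtain ⟨hm, h0, hone⟩ := hd
  intro u hu
  rcases hu.1.eq_or_lt with rfl | hu0
  · have hle : ∀ v ∈ Icc (0 : ℝ) 1, h v ≤ v := fun v hv => by
      have := hc.2 (x := 0) (y := 1) ⟨le_rfl, zero_le_one⟩ ⟨zero_le_one, le_rfl⟩
        (sub_nonneg.2 hv.2) hv.1 (by ring)
      simpa [h0, hone] using this
    rw [ContinuousWithinAt, h0]
    refine tendsto_of_tendsto_of_tendsto_of_le_of_le' tendsto_const_nhds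
      (Filter.Tendsto.mono_left Filter.tendsto_id nhdsWithin_le_nhds) ?_ ?_
    · exact eventually_nhdsWithin_of_forall fun v hv => h0 ▸ hm ⟨le_rfl, zero_le_one⟩ hv hv.1
    · exact eventually_nhdsWithin_of_forall hle
  rcases hu.2.eq_or_lt with rfl | hu1
  · have := (hasDerivWithinAt_hD_one h1).continuousWithinAt
    rw [← continuousWithinAt_insert_self, Iio_insert] at this
    exact this.mono fun v hv => hv.2
  · have := (hc.subset Ioo_subset_Icc_self (convex_Ioo 0 1)).continuousOn isOpen_Ioo
    exact (this.continuousAt (Ioo_mem_nhds hu0 hu1)).continuousWithinAt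

lemma aemeasurable_hD (hc : ConvexOn ℝ (Icc 0 1) h) :
    AEMeasurable (hD h) (volume.restrict (Ioo 0 1)) :=
  aemeasurable_restrict_of_monotoneOn measurableSet_Ioo (monotoneOn_hD hc)

lemma memLp_hD (hH : MemH2 h) : MemLp (hD h) 2 (volume.restrict (Ioo 0 1)) :=
  (memLp_two_iff_integrable_sq (aemeasurable_hD hH.2.1).aestronglyMeasurable).2 hH.2.2

/-- Fundamental theorem of calculus for the left derivative of a convex distortion. -/
lemma integral_hD (hH : MemH2 h) (h1 : hD h 1 ≠ 0) {a : ℝ} (ha : a ∈ Icc (0 : ℝ) 1) :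
    ∫ u in Ioc a 1, hD h u = 1 - h a := by
  have hd := hH.1
  have hc := hH.2.1
  have hint : IntegrableOn (hD h) (Ioo a 1) :=
    IntegrableOn.mono_set ((memLp_hD hH).integrable one_le_two) (Ioo_subset_Ioo_left ha.1)
  have hint' : IntervalIntegrable (hD h) volume a 1 :=
    (intervalIntegrable_iff_integrableOn_Ioo_of_le ha.2).2 hint
  have hneg : IntervalIntegrable (fun x => hD h (-x)) volume (-1) (-a) := by
    rw [IntervalIntegrable.iff_comp_neg]
    simpa using hint'.symm
  have key := intervalIntegral.integral_eq_sub_of_hasDeriv_right_of_le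
    (f := fun x => -h (-x)) (f' := fun x => hD h (-x)) (neg_le_neg ha.2)
    (((continuousOn_distortion hd hc h1).comp continuousOn_neg fun x hx =>
      ⟨by linarith [hx.2, ha.1], by linarith [hx.1]⟩).neg) (fun x hx => ?_) hneg
  · rw [intervalIntegral.integral_comp_neg (fun x => hD h x)] at key
    rw [← intervalIntegral.integral_of_le ha.2]
    simpa [hd.2.2, sub_eq_neg_add, add_comm] using key
  · have hx' : -x ∈ Ioo (0 : ℝ) 1 := ⟨by linarith [hx.2, ha.1], by linarith [hx.1]⟩
    have := ((hasDerivWithinAt_hD hc hx').scomp x (hasDerivWithinAt_neg x (Ioi x))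
      fun y hy => neg_lt_neg (mem_Ioi.1 hy)).neg
    simpa [Function.comp_def, Pi.neg_def] using this

lemma sstar_mem (hH : MemH2 h) (h1 : hD h 1 ≠ 0) {β : ℝ} (hβ : β ∈ Ioo (0 : ℝ) 1) :
    sstar h β ∈ Ioo (0 : ℝ) 1 ∧ h (sstar h β) = β := by
  obtain ⟨hd, hc, -⟩ := hH
  have hcont := continuousOn_distortion hd hc h1
  obtain ⟨hm, h0, hone⟩ := hd
  let A := {u ∈ Icc (0 : ℝ) 1 | β ≤ h u}
  have hcl : IsClosed A := hcont.preimage_isClosed_of_isClosed isClosed_Icc isClosed_Ici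
  have hbdd : BddBelow A := ⟨0, fun u hu => hu.1.1⟩
  have hmem : sInf A ∈ A :=
    hcl.csInf_mem ⟨1, ⟨zero_le_one, le_rfl⟩, hβ.2.le.trans_eq hone.symm⟩ hbdd
  obtain ⟨v, hv, hvβ⟩ : β ∈ h '' Icc 0 1 :=
    intermediate_value_Icc zero_le_one hcont ⟨h0.trans_le hβ.1.le, hβ.2.le.trans_eq hone.symm⟩
  have heq : h (sInf A) = β :=
    le_antisymm (hvβ ▸ hm hmem.1 hv (csInf_le hbdd ⟨hv, hvβ.ge⟩)) hmem.2
  refine ⟨⟨lt_of_le_of_ne hmem.1.1 fun e => ?_, lt_of_le_of_ne hmem.1.2 fun e => ?_⟩, heq⟩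
  · rw [← (show (0 : ℝ) = sInf A from e), h0] at heq
    exact hβ.1.ne heq
  · rw [show sInf A = 1 from e, hone] at heq
    exact hβ.2.ne' heq

end Distortion

section Truncation

variable {h : ℝ → ℝ}

/-- The derivative of `h`, truncated to levels above `s`. -/
noncomputable def tail (h : ℝ → ℝ) (s : ℝ) : ℝ → ℝ := (Ioi s).indicator (hD h)

lemma tail_of_lt {s u : ℝ} (hu : s < u) : tail h s u = hD h u := indicator_of_mem (mem_Ioi.2 hu) _

lemma tail_of_le {s u : ℝ} (hu : u ≤ s) : tail h s u = 0 :=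
  indicator_of_notMem (notMem_Ioi.2 hu) _

lemma memLp_tail (hH : MemH2 h) (s : ℝ) : MemLp (tail h s) 2 (volume.restrict (Ioo 0 1)) :=
  (memLp_hD hH).indicator measurableSet_Ioi

lemma setIntegral_indicator_Ioi {f : ℝ → ℝ} {s : ℝ} (hs : 0 ≤ s) :
    ∫ u in Ioo (0 : ℝ) 1, (Ioi s).indicator f u = ∫ u in Ioc s 1, f u := by
  rw [setIntegral_indicator measurableSet_Ioi, integral_Ioc_eq_integral_Ioo]
  congr 2
  ext u
  simp only [mem_inter_iff, mem_Ioo, mem_Ioi]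
  exact ⟨fun h => ⟨h.2, h.1.2⟩, fun h => ⟨⟨hs.trans_lt h.1, h.2⟩, h.1⟩⟩

lemma integral_tail (hH : MemH2 h) (h1 : hD h 1 ≠ 0) {s : ℝ} (hs : s ∈ Icc (0 : ℝ) 1) :
    ∫ u in Ioo (0 : ℝ) 1, tail h s u = 1 - h s := by
  rw [← integral_hD hH h1 hs]
  exact setIntegral_indicator_Ioi hs.1

lemma integral_hD_Ioo (hH : MemH2 h) (h1 : hD h 1 ≠ 0) : ∫ u in Ioo (0 : ℝ) 1, hD h u = 1 := by
  rw [← integral_Ioc_eq_integral_Ioo, integral_hD hH h1 ⟨le_rfl, zero_le_one⟩, hH.1.2.1, sub_zero]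

lemma integral_tail_sq {s : ℝ} (hs : 0 ≤ s) :
    ∫ u in Ioo (0 : ℝ) 1, tail h s u ^ 2 = ∫ u in Ioc s 1, hD h u ^ 2 := by
  rw [← setIntegral_indicator_Ioi hs]
  congr 1 with u
  by_cases hu : s < u
  · rw [tail_of_lt hu, indicator_of_mem (mem_Ioi.2 hu)]
  · rw [tail_of_le (not_lt.1 hu), indicator_of_notMem (notMem_Ioi.2 (not_lt.1 hu))]
    simp

/-- Changing the truncation level from `a` to `s` moves the second moment by at most `τ` times the
change in `h`, for any subgradient `τ` of `h` at `a`. -/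
lemma integral_tail_sq_sub_le (hH : MemH2 h) (h1 : hD h 1 ≠ 0) {a s τ : ℝ}
    (ha : a ∈ Ioo (0 : ℝ) 1) (hs : s ∈ Icc (0 : ℝ) 1)
    (hτ : τ ∈ Icc (hD h a) (derivWithin h (Ioi a) a)) :
    (∫ u in Ioo (0 : ℝ) 1, tail h s u ^ 2) - ∫ u in Ioo (0 : ℝ) 1, tail h a u ^ 2
      ≤ τ * (h a - h s) := by
  have hI (t : ℝ) := (memLp_tail hH t).integrable one_le_two
  have hI2 (t : ℝ) := (memLp_tail hH t).integrable_sq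
  have e : τ * (h a - h s) = ∫ u in Ioo (0 : ℝ) 1, τ * (tail h s u - tail h a u) := by
    rw [integral_const_mul, integral_sub (hI s) (hI a), integral_tail hH h1 hs,
      integral_tail hH h1 (Ioo_subset_Icc_self ha)]
    ring
  rw [e, ← integral_sub (hI2 s) (hI2 a)]
  refine setIntegral_mono_on ((hI2 s).sub (hI2 a)) (((hI s).sub (hI a)).const_mul τ)
    measurableSet_Ioo fun u hu => ?_
  have h0 := hD_nonneg hH.1.1 hu
  rcases le_or_gt u s with hus | hus <;> rcases le_or_gt u a with hua | hua
  · simp [tail_of_le hus, tail_of_le hua]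
  · have := hτ.2.trans (rightDeriv_le_hD hH.2.1 ha.1 hua hu.2)
    rw [tail_of_le hus, tail_of_lt hua]
    nlinarith
  · have := (monotoneOn_hD hH.2.1 hu ha hua).trans hτ.1
    rw [tail_of_lt hus, tail_of_le hua]
    nlinarith
  · simp [tail_of_lt hus, tail_of_lt hua]

end Truncation

section Risk

variable {h : ℝ → ℝ} {p c μ σ x : ℝ} {P : Measure ℝ}

lemma rho_loss [IsProbabilityMeasure P] (hp : 0 < p) :
    rho h P (loss p c x) =
      ∫ u in Ioo (0 : ℝ) 1, (p * max (VaR P (fun s => -s) u) (-x) + c * x) * hD h u :=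
  setIntegral_congr_fun measurableSet_Ioo fun u hu => by
    simp only [VaR_loss hp hu]

lemma memLp_VaR_neg (hμ : 0 < μ) (hP : P ∈ momentSet μ σ) :
    MemLp (VaR P (fun s => -s)) 2 (volume.restrict (Ioo 0 1)) := by
  obtain ⟨_, -, -, h2⟩ := hP
  have hid : MemLp (fun s : ℝ => s) 2 P :=
    (memLp_two_iff_integrable_sq (by fun_prop)).2
      (Integrable.of_integral_ne_zero (by rw [h2]; positivity))
  have hmap : MemLp id 2 (P.map fun s => -s) :=
    (memLp_map_measure_iff aestronglyMeasurable_id measurable_neg.aemeasurable).2 hid.neg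
  rw [← map_VaR measurable_neg] at hmap
  exact (memLp_map_measure_iff aestronglyMeasurable_id (aemeasurable_VaR measurable_neg)).1 hmap

lemma integral_VaR_neg (hP : P ∈ momentSet μ σ) :
    ∫ u in Ioo (0 : ℝ) 1, VaR P (fun s => -s) u = -μ := by
  obtain ⟨_, -, h1, -⟩ := hP
  have hm {Q : Measure ℝ} : AEStronglyMeasurable (fun y : ℝ => y) Q := by fun_prop
  have := integral_map (aemeasurable_VaR (P := P) measurable_neg)
    (f := fun y : ℝ => y) hm
  rw [← this, map_VaR measurable_neg, integral_map measurable_neg.aemeasurable hm, integral_neg, h1]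

lemma integral_VaR_neg_sq (hP : P ∈ momentSet μ σ) :
    ∫ u in Ioo (0 : ℝ) 1, VaR P (fun s => -s) u ^ 2 = μ ^ 2 + σ ^ 2 := by
  obtain ⟨_, -, -, h2⟩ := hP
  have hm {Q : Measure ℝ} : AEStronglyMeasurable (fun y : ℝ => y ^ 2) Q := by fun_prop
  have := integral_map (aemeasurable_VaR (P := P) measurable_neg)
    (f := fun y : ℝ => y ^ 2) hm
  rw [← this, map_VaR measurable_neg, integral_map measurable_neg.aemeasurable hm, ← h2]
  simp

lemma VaR_neg_nonpos (hP : P ∈ momentSet μ σ) {u : ℝ} (hu : u ∈ Ioo (0 : ℝ) 1) :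
    VaR P (fun s => -s) u ≤ 0 := by
  obtain ⟨_, h0, -, -⟩ := hP
  rw [VaR_le_iff measurable_neg hu]
  have : {ω : ℝ | -ω ≤ 0} = (Iio 0)ᶜ := by ext; simp
  rw [this, (prob_compl_eq_one_iff measurableSet_Iio).2 h0]
  simpa using hu.2.le

lemma integrable_loss_mul_hD (hμ : 0 < μ) (hH : MemH2 h) (hP : P ∈ momentSet μ σ) :
    IntegrableOn (fun u => (p * max (VaR P (fun s => -s) u) (-x) + c * x) * hD h u)
      (Ioo 0 1) :=
  ((((memLp_VaR_neg hμ hP).sup (memLp_const (-x))).const_mul p).add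
    (memLp_const (c * x))).integrable_mul (memLp_hD hH)

lemma bddAbove_rho (hp : 0 < p) (hμ : 0 < μ) (hH : MemH2 h) (hx : 0 ≤ x) :
    BddAbove ((fun P => rho h P (loss p c x)) '' momentSet μ σ) := by
  refine ⟨∫ u in Ioo (0 : ℝ) 1, c * x * hD h u, ?_⟩
  rintro _ ⟨P, hP, rfl⟩
  have := hP.1
  simp only [rho_loss hp]
  refine setIntegral_mono_on (integrable_loss_mul_hD hμ hH hP)
    (((memLp_hD hH).integrable one_le_two).const_mul _) measurableSet_Ioo fun u hu => ?_
  have hmax : max (VaR P (fun s => -s) u) (-x) ≤ 0 :=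
    max_le (VaR_neg_nonpos hP hu) (neg_nonpos.2 hx)
  have := hD_nonneg hH.1.1 hu
  gcongr
  nlinarith

/-- Integral of the loss that orders `x` up to level `s` and sells the whole demand above it. -/
lemma integral_tail_eq (hH : MemH2 h) (h1 : hD h 1 ≠ 0) (hμ : 0 < μ) (hP : P ∈ momentSet μ σ)
    {s : ℝ} (hs : s ∈ Icc (0 : ℝ) 1) :
    IntegrableOn (fun u => p * (VaR P (fun s => -s) u * tail h s u - x * (hD h u - tail h s u))
      + c * x * hD h u) (Ioo 0 1) ∧
    ∫ u in Ioo (0 : ℝ) 1, (p * (VaR P (fun s => -s) u * tail h s u - x * (hD h u - tail h s u))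
      + c * x * hD h u) =
    p * ((∫ u in Ioo (0 : ℝ) 1, VaR P (fun s => -s) u * tail h s u) - x * h s) + c * x := by
  have hT := (memLp_tail hH s).integrable one_le_two
  have hD' := (memLp_hD hH).integrable one_le_two
  have hVT := (memLp_VaR_neg hμ hP).integrable_mul (memLp_tail hH s)
  have hA := (hD'.sub hT).const_mul x
  refine ⟨((hVT.sub hA).const_mul p).add (hD'.const_mul (c * x)), ?_⟩
  rw [integral_add (by exact (hVT.sub hA).const_mul p) (hD'.const_mul (c * x)), integral_const_mul,
    integral_const_mul, integral_sub (by exact hVT) (by exact hA), integral_const_mul,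
    integral_sub hD' hT]
  rw [integral_tail hH h1 hs, integral_hD_Ioo hH h1]
  ring

/-- The integral of a quadratic polynomial in two square integrable functions, without the mixed
term. -/
lemma integral_quadratic {f g : ℝ → ℝ} (hf : MemLp f 2 (volume.restrict (Ioo (0 : ℝ) 1)))
    (hg : MemLp g 2 (volume.restrict (Ioo (0 : ℝ) 1))) (a b d e k : ℝ) :
    IntegrableOn (fun u => a * f u ^ 2 + b * f u + d * g u ^ 2 + e * g u + k) (Ioo (0 : ℝ) 1) ∧
    ∫ u in Ioo (0 : ℝ) 1, (a * f u ^ 2 + b * f u + d * g u ^ 2 + e * g u + k) =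
      a * (∫ u in Ioo (0 : ℝ) 1, f u ^ 2) + b * (∫ u in Ioo (0 : ℝ) 1, f u) +
        d * (∫ u in Ioo (0 : ℝ) 1, g u ^ 2) + e * (∫ u in Ioo (0 : ℝ) 1, g u) + k := by
  have i1 := hf.integrable_sq.const_mul a
  have i2 := (hf.integrable one_le_two).const_mul b
  have i3 := hg.integrable_sq.const_mul d
  have i4 := (hg.integrable one_le_two).const_mul e
  have i5 : Integrable (fun _ => k) (volume.restrict (Ioo (0 : ℝ) 1)) := integrable_const k
  refine ⟨(((i1.add i2).add i3).add i4).add i5, ?_⟩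
  rw [integral_add (by exact ((i1.add i2).add i3).add i4) i5,
    integral_add (by exact (i1.add i2).add i3) i4, integral_add (by exact i1.add i2) i3,
    integral_add i1 i2]
  simp [integral_const_mul]

/-- At the order quantity given by a subgradient `τ` of `h` at `a`, no distribution exceeds the
saddle value. -/
lemma rho_loss_le (hp : 0 < p) (hμ : 0 < μ) (hσ : 0 < σ) (hH : MemH2 h) (h1 : hD h 1 ≠ 0)
    {a τ Δ : ℝ} (ha : a ∈ Ioo (0 : ℝ) 1)
    (hτ : τ ∈ Icc (hD h a) (derivWithin h (Ioi a) a)) (hΔ : 0 < Δ)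
    (hΔ2 : Δ ^ 2 = (∫ u in Ioo (0 : ℝ) 1, tail h a u ^ 2) - (1 - h a) ^ 2)
    (hc : c = p * h a) (hx : x = μ - σ * (τ - 2 * (1 - h a)) / (2 * Δ))
    (hP : P ∈ momentSet μ σ) :
    rho h P (loss p c x) ≤ p * (σ * Δ - μ * (1 - h a)) := by
  have := hP.1
  set V := VaR P (fun s => -s) with hV
  set s := (P {ω | -ω ≤ -x}).toReal
  have hs : s ∈ Icc (0 : ℝ) 1 := ⟨ENNReal.toReal_nonneg, measureReal_le_one⟩
  have hVLp : MemLp V 2 (volume.restrict (Ioo 0 1)) := memLp_VaR_neg hμ hP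
  have hTLp := memLp_tail hH s
  have hsplit : rho h P (loss p c x) =
      p * ((∫ u in Ioo (0 : ℝ) 1, V u * tail h s u) - x * h s) + c * x := by
    rw [rho_loss hp, ← (integral_tail_eq hH h1 hμ hP hs).2]
    refine setIntegral_congr_fun measurableSet_Ioo fun u hu => ?_
    have hiff : V u ≤ -x ↔ u ≤ s := VaR_le_iff measurable_neg hu (-x)
    simp only [← hV]
    rcases le_or_gt u s with hus | hus
    · rw [max_eq_right (hiff.2 hus), tail_of_le hus]
      ring
    · rw [max_eq_left (not_le.1 (mt hiff.1 hus.not_ge)).le, tail_of_lt hus]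
      ring
  set m := 1 - h s with hm
  have hamgm : ∫ u in Ioo (0 : ℝ) 1, V u * tail h s u ≤
      σ * Δ / 2 + σ / (2 * Δ) * ((∫ u in Ioo (0 : ℝ) 1, tail h s u ^ 2) - m ^ 2) - μ * m := by
    obtain ⟨hint, heq⟩ := integral_quadratic hVLp hTLp (Δ / (2 * σ)) (m + Δ / σ * μ)
      (σ / (2 * Δ)) (-μ - σ / Δ * m) (μ * m + Δ / (2 * σ) * μ ^ 2 + σ / (2 * Δ) * m ^ 2)
    rw [integral_VaR_neg_sq hP, integral_VaR_neg hP, integral_tail hH h1 hs] at heq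
    have hmono := setIntegral_mono_on (hVLp.integrable_mul hTLp) hint measurableSet_Ioo
      fun u _ => ?_
    · refine hmono.trans_eq (heq.trans ?_)
      field_simp
      ring
    · have hsq : 0 ≤ (Δ * (V u + μ) - σ * (tail h s u - m)) ^ 2 / (2 * σ * Δ) := by positivity
      refine sub_nonneg.1 (hsq.trans_eq ?_)
      simp only [Pi.mul_apply]
      field_simp
      ring
  have hB := integral_tail_sq_sub_le hH h1 ha hs hτ
  set B := ∫ u in Ioo (0 : ℝ) 1, tail h s u ^ 2
  rw [hsplit, hc]
  have hstep : σ / (2 * Δ) * (B - m ^ 2) ≤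
      σ / (2 * Δ) * (Δ ^ 2 + (1 - h a) ^ 2 + τ * (h a - h s) - m ^ 2 + (h a - h s) ^ 2) := by
    gcongr
    nlinarith [sq_nonneg (h a - h s)]
  have hfin : σ / (2 * Δ) * (Δ ^ 2 + (1 - h a) ^ 2 + τ * (h a - h s) - m ^ 2 + (h a - h s) ^ 2) =
      σ * Δ / 2 - (x - μ) * (h a - h s) := by
    rw [hx, hm]
    field_simp
    ring
  have hgoal : (∫ u in Ioo (0 : ℝ) 1, V u * tail h s u) - x * h s + h a * x ≤
      σ * Δ - μ * (1 - h a) := by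
    rw [hm] at hamgm
    linarith [hstep.trans_eq hfin]
  calc _ = p * ((∫ u in Ioo (0 : ℝ) 1, V u * tail h s u) - x * h s + h a * x) := by ring
    _ ≤ _ := by gcongr

/-- The least favourable distribution, whose quantile function is affine in `tail h a`. -/
lemma exists_momentSet_le_rho (hp : 0 < p) (hμ : 0 < μ) (hσ : 0 < σ) (hH : MemH2 h)
    (h1 : 0 < hD h 1) {a Δ : ℝ} (ha : a ∈ Ioo (0 : ℝ) 1) (hΔ : 0 < Δ)
    (hΔ2 : Δ ^ 2 = (∫ u in Ioo (0 : ℝ) 1, tail h a u ^ 2) - (1 - h a) ^ 2)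
    (hc : c = p * h a) (hr : σ * (hD h 1 - (1 - h a)) ≤ Δ * μ) :
    ∃ P ∈ momentSet μ σ, ∀ x, p * (σ * Δ - μ * (1 - h a)) ≤ rho h P (loss p c x) := by
  have ha' := Ioo_subset_Icc_self ha
  have hTLp := memLp_tail hH a
  have hT1 := integral_tail hH h1.ne' ha'
  set m := 1 - h a with hm
  set k := σ / Δ with hk
  have hk0 : 0 < k := by positivity
  set W : ℝ → ℝ := fun u => -μ + k * (tail h a u - m) with hW
  have hTmono : MonotoneOn (tail h a) (Ioo 0 1) := by
    intro u hu v hv huv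
    rcases le_or_gt u a with hua | hua
    · rw [tail_of_le hua]
      exact indicator_apply_nonneg fun _ => hD_nonneg hH.1.1 hv
    · rw [tail_of_lt hua, tail_of_lt (hua.trans_le huv)]
      exact monotoneOn_hD hH.2.1 hu hv huv
  have hWmono : MonotoneOn W (Ioo 0 1) := fun u hu v hv huv => by
    have := hTmono hu hv huv
    simp only [hW]
    gcongr
  have hWLp : MemLp W 2 (volume.restrict (Ioo 0 1)) :=
    (memLp_const (-μ)).add ((hTLp.sub (memLp_const m)).const_mul k)
  have hWneg : AEMeasurable (fun u => -W u) (volume.restrict (Ioo 0 1)) :=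
    hWLp.1.aemeasurable.neg
  have hW0 : ∀ u ∈ Ioo (0 : ℝ) 1, W u ≤ 0 := fun u hu => by
    have hT : tail h a u ≤ hD h 1 :=
      indicator_apply_le' (fun _ => hD_le_hD_one hH.2.1 h1.ne' hu) (fun _ => h1.le)
    have hkr : k * (hD h 1 - m) ≤ μ := by
      rw [hk, div_mul_eq_mul_div, div_le_iff₀ hΔ]
      linarith
    have : k * (tail h a u - m) ≤ k * (hD h 1 - m) := by gcongr
    simp only [hW]
    linarith
  have hWint : ∫ u in Ioo (0 : ℝ) 1, W u = -μ := by
    have := (integral_quadratic hTLp hTLp 0 k 0 0 (-μ - k * m)).2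
    rw [hT1] at this
    calc _ = _ := by congr 1 with u; simp only [hW]; ring
      _ = _ := this
      _ = _ := by ring
  have hWint2 : ∫ u in Ioo (0 : ℝ) 1, W u ^ 2 = μ ^ 2 + σ ^ 2 := by
    have := (integral_quadratic hTLp hTLp (k ^ 2) (2 * k * (-μ - k * m)) 0 0 ((-μ - k * m) ^ 2)).2
    rw [hT1] at this
    calc _ = _ := by congr 1 with u; simp only [hW]; ring
      _ = _ := this
      _ = μ ^ 2 + k ^ 2 * ((∫ u in Ioo (0 : ℝ) 1, tail h a u ^ 2) - m ^ 2) := by ring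
      _ = _ := by rw [← hΔ2, hk]; field_simp
  set P := (volume.restrict (Ioo (0 : ℝ) 1)).map fun u => -W u with hPdef
  have hPprob : IsProbabilityMeasure P := Measure.isProbabilityMeasure_map hWneg
  have hP : P ∈ momentSet μ σ := by
    refine ⟨hPprob, ?_, ?_, ?_⟩
    · rw [hPdef, Measure.map_apply_of_aemeasurable hWneg measurableSet_Iio,
        Measure.restrict_apply' measurableSet_Ioo]
      convert measure_empty (μ := (volume : Measure ℝ))
      ext u
      simp only [mem_inter_iff, mem_preimage, mem_Iio, mem_empty_iff_false, iff_false, not_and]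
      exact fun hu hu' => by linarith [hW0 u hu']
    · rw [hPdef, integral_map hWneg (by fun_prop), integral_neg, hWint, neg_neg]
    · rw [hPdef, integral_map hWneg (by fun_prop)]
      simpa using hWint2
  have hle : ∀ u ∈ Ioo (0 : ℝ) 1, VaR P (fun s => -s) u ≤ W u := fun u hu => by
    rw [VaR_le_iff measurable_neg hu, ← ENNReal.ofReal_le_iff_le_toReal (measure_ne_top _ _), hPdef,
      Measure.map_apply_of_aemeasurable hWneg (measurableSet_le measurable_neg measurable_const),
      Measure.restrict_apply' measurableSet_Ioo]
    have hsub : Ioc 0 u ⊆ (fun u => -W u) ⁻¹' {ω | -ω ≤ W u} ∩ Ioo 0 1 := fun v hv => by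
      have hv' : v ∈ Ioo (0 : ℝ) 1 := ⟨hv.1, hv.2.trans_lt hu.2⟩
      exact ⟨by simpa using hWmono hv' hu hv.2, hv'⟩
    calc ENNReal.ofReal u = volume (Ioc 0 u) := by simp
      _ ≤ _ := measure_mono hsub
  have hae : VaR P (fun s => -s) =ᵐ[volume.restrict (Ioo 0 1)] W :=
    (integral_eq_iff_of_ae_le ((memLp_VaR_neg hμ hP).integrable one_le_two)
      (hWLp.integrable one_le_two)
      ((ae_restrict_iff' measurableSet_Ioo).2 (.of_forall hle))).1
      ((integral_VaR_neg hP).trans hWint.symm)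
  have hWT : ∫ u in Ioo (0 : ℝ) 1, VaR P (fun s => -s) u * tail h a u = σ * Δ - μ * m := by
    have := (integral_quadratic hTLp hTLp k (-μ - k * m) 0 0 0).2
    rw [hT1] at this
    calc _ = ∫ u in Ioo (0 : ℝ) 1, W u * tail h a u :=
          integral_congr_ae (hae.mul (ae_eq_refl _))
      _ = _ := by congr 1 with u; simp only [hW]; ring
      _ = _ := this
      _ = k * ((∫ u in Ioo (0 : ℝ) 1, tail h a u ^ 2) - m ^ 2) - μ * m := by ring
      _ = _ := by rw [← hΔ2, hk]; field_simp
  refine ⟨P, hP, fun x => ?_⟩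
  obtain ⟨hint, heq⟩ := integral_tail_eq (p := p) (c := c) (x := x) hH h1.ne' hμ hP ha'
  rw [hWT] at heq
  have hsaddle : p * (σ * Δ - μ * m) = p * (σ * Δ - μ * m - x * h a) + c * x := by
    rw [hc]; ring
  rw [hsaddle, ← heq, rho_loss hp]
  refine setIntegral_mono_on hint (integrable_loss_mul_hD hμ hH hP) measurableSet_Ioo
    fun u hu => ?_
  have h0 := hD_nonneg hH.1.1 hu
  rw [add_mul, mul_assoc p]
  gcongr
  rcases le_or_gt u a with hua | hua
  · rw [tail_of_le hua]
    nlinarith [le_max_right (VaR P (fun s => -s) u) (-x)]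
  · rw [tail_of_lt hua]
    nlinarith [le_max_left (VaR P (fun s => -s) u) (-x)]

end Risk

end NV

/-- Low demand uncertainty case: the optimal order quantity. -/
theorem stmt2 (p c μ σ : ℝ) (hc : 0 < c) (hcp : c < p) (hμ : 0 < μ) (hσ : 0 < σ)
    (h : ℝ → ℝ) (hH2 : MemH2 h)
    (hr : σ / μ ≤ Del h (c / p) (sstar h (c / p)) 1 / (hD h 1 - (1 - c / p)))
    (htau : ℝ)
    (htmem : htau ∈ Set.Icc (hD h (sstar h (c / p)))
        (derivWithin h (Set.Ioi (sstar h (c / p))) (sstar h (c / p))))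
    (xs : ℝ)
    (hxs : xs = μ - σ * (htau - 2 * (1 - c / p)) / (2 * Del h (c / p) (sstar h (c / p)) 1)) :
    0 ≤ xs ∧ wcInner h p c μ σ xs = wcRisk h p c μ σ := by
  have hp : 0 < p := hc.trans hcp
  have hβ : c / p ∈ Ioo (0 : ℝ) 1 := ⟨div_pos hc hp, (div_lt_one hp).2 hcp⟩
  have hpos := (div_pos hσ hμ).trans_le hr
  obtain ⟨hΔ, hden⟩ : 0 < Del h (c / p) (sstar h (c / p)) 1 ∧ 0 < hD h 1 - (1 - c / p) := by
    rcases div_pos_iff.1 hpos with hpos | hneg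
    · exact hpos
    · exact absurd hneg.1 (Real.sqrt_nonneg _).not_gt
  have h1 : 0 < hD h 1 := by linarith [hβ.2]
  obtain ⟨ha, hha⟩ := sstar_mem hH2 h1.ne' hβ
  have hΔ2 := Real.sq_sqrt (Real.sqrt_pos.1 hΔ).le
  rw [← Del, one_mul, hH2.1.2.2, ← integral_tail_sq ha.1.le] at hΔ2
  rw [div_le_div_iff₀ hμ hden] at hr
  have hτ1 : htau ≤ hD h 1 := htmem.2.trans (rightDeriv_le_hD_one hH2.2.1 h1.ne' ha)
  have hcβ : c = p * (c / p) := by field_simp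
  set Δ := Del h (c / p) (sstar h (c / p)) 1
  set a := sstar h (c / p)
  set β := c / p
  rw [← hha] at hΔ2 hr hxs hcβ
  have hxs0 : 0 ≤ xs := by
    rw [hxs, sub_nonneg, div_le_iff₀ (by positivity)]
    nlinarith
  refine ⟨hxs0, ?_⟩
  obtain ⟨P, hP, hPle⟩ := exists_momentSet_le_rho hp hμ hσ hH2 h1 ha hΔ hΔ2 hcβ hr
  have hlower : ∀ x, 0 ≤ x → p * (σ * Δ - μ * (1 - h a)) ≤ wcInner h p c μ σ x := fun x hx =>
    (hPle x).trans (le_csSup (bddAbove_rho hp hμ hH2 hx) ⟨P, hP, rfl⟩)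
  have hupper : wcInner h p c μ σ xs ≤ p * (σ * Δ - μ * (1 - h a)) := by
    refine csSup_le ⟨_, P, hP, rfl⟩ ?_
    rintro _ ⟨Q, hQ, rfl⟩
    exact rho_loss_le hp hμ hσ hH2 h1.ne' ha htmem hΔ hΔ2 hcβ hxs hQ
  refine le_antisymm (le_csInf ⟨_, xs, hxs0, rfl⟩ ?_)
    (csInf_le ⟨p * (σ * Δ - μ * (1 - h a)), ?_⟩ ⟨xs, hxs0, rfl⟩)
  · rintro _ ⟨x, hx, rfl⟩
    exact hupper.trans (hlower x hx)
  · rintro _ ⟨x, hx, rfl⟩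
    exact hlower x hx
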